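/- Let P ∈ 𝔓_+(N). Then the moment map F^P maps 𝔓_+(N) bijectively onto ℭ_+(N), and both F^P and its inverse are continuous; i.e., F^P : 𝔓_+(N) → ℭ_+(N) is a homeomorphism. -/

import Mathlib

open Complex Finset Filter Topology

noncomputable section

/-- Coefficient space for symmetric trigonometric polynomials of degree `n`:
`(p₀, (p₁, …, pₙ))` with `p₀` real and `p₋ₖ = conj pₖ` implicit. Also used for
covariance data `c = (c₀, (c₁, …, cₙ))`. -/
abbrev Coef (n : ℕ) := ℝ × (Fin n → ℂ)

/-- The `2N`-th roots of unity `ζ_j = exp(iπj/N)`. -/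
def zet (N : ℕ) (j : ℤ) : ℂ := Complex.exp (Real.pi * Complex.I * j / N)

/-- The index set `j = -N+1, …, N`. -/
def idxs (N : ℕ) : Finset ℤ := Finset.Icc (-(N : ℤ) + 1) N

/-- Evaluation of `P(z) = Σ_{k=-n}^n p_k z^{-k}` (with `p₋ₖ = conj pₖ`). -/
def evalC {n : ℕ} (p : Coef n) (z : ℂ) : ℂ :=
  (p.1 : ℂ) + ∑ k : Fin n,
    (p.2 k * z⁻¹ ^ ((k : ℕ) + 1) + (starRingEnd ℂ) (p.2 k) * z ^ ((k : ℕ) + 1))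

/-- Real value of the symmetric trigonometric polynomial on the unit circle. -/
def evalR {n : ℕ} (p : Coef n) (z : ℂ) : ℝ := (evalC p z).re

/-- The open cone `𝔓₊(N)`. -/
def Pplus (n N : ℕ) : Set (Coef n) := {p | ∀ j ∈ idxs N, 0 < evalR p (zet N j)}

/-- The closure of `𝔓₊(N)`: `P(ζ_j) ≥ 0` for all `j`. -/
def Pnn (n N : ℕ) : Set (Coef n) := {p | ∀ j ∈ idxs N, 0 ≤ evalR p (zet N j)}

/-- The cone `𝔓₊` of trigonometric polynomials positive on the whole circle. -/
def PplusC (n : ℕ) : Set (Coef n) :=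
  {p | ∀ θ ∈ Set.Icc (-Real.pi) Real.pi, 0 < evalR p (Complex.exp (θ * Complex.I))}

/-- The closure of `𝔓₊`: nonnegative on the whole circle. -/
def PnnC (n : ℕ) : Set (Coef n) :=
  {p | ∀ θ ∈ Set.Icc (-Real.pi) Real.pi, 0 ≤ evalR p (Complex.exp (θ * Complex.I))}

/-- The pairing `⟨C,P⟩ = Σ_{k=-n}^n c_k conj(p_k)` (a real number). -/
def pairCP {n : ℕ} (c p : Coef n) : ℝ :=
  c.1 * p.1 + ∑ k : Fin n, 2 * (c.2 k * (starRingEnd ℂ) (p.2 k)).re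

/-- The open dual cone `ℭ₊(N)`. -/
def Cplus (n N : ℕ) : Set (Coef n) := {c | ∀ p ∈ Pnn n N, p ≠ 0 → 0 < pairCP c p}

/-- The open dual cone `ℭ₊`. -/
def CplusC (n : ℕ) : Set (Coef n) := {c | ∀ p ∈ PnnC n, p ≠ 0 → 0 < pairCP c p}

/-- The discrete moment `(1/(2N)) Σ_j ζ_j^k Φ(ζ_j)`. -/
def dmom (N : ℕ) (Φ : ℤ → ℝ) (k : ℤ) : ℂ :=
  (1 / (2 * (N : ℂ))) * ∑ j ∈ idxs N, zet N j ^ k * (Φ j : ℂ)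

/-- `Φ` (a function of the index `j`) satisfies the moment conditions for `c`. -/
def MomCond {n : ℕ} (N : ℕ) (c : Coef n) (Φ : ℤ → ℝ) : Prop :=
  dmom N Φ 0 = (c.1 : ℂ) ∧ ∀ k : Fin n, dmom N Φ ((k : ℕ) + 1) = c.2 k

/-- The function `j ↦ P(ζ_j)/Q(ζ_j)`. -/
def phiOf {n : ℕ} (N : ℕ) (P Q : Coef n) : ℤ → ℝ :=
  fun j => evalR P (zet N j) / evalR Q (zet N j)

/-- The dual functional `J_P(Q) = ⟨C,Q⟩ − (1/(2N)) Σ_j P(ζ_j) log Q(ζ_j)`. -/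
def JP {n : ℕ} (N : ℕ) (c P Q : Coef n) : ℝ :=
  pairCP c Q - (1 / (2 * (N : ℝ))) * ∑ j ∈ idxs N,
    evalR P (zet N j) * Real.log (evalR Q (zet N j))

/-- The moment map `F^P`, with components `F^P_k(Q) = (1/(2N)) Σ_j ζ_j^k P(ζ_j)/Q(ζ_j)`. -/
def Fmap {n : ℕ} (N : ℕ) (P Q : Coef n) : Coef n :=
  ((dmom N (phiOf N P Q) 0).re, fun k => dmom N (phiOf N P Q) ((k : ℕ) + 1))

section ConeMoment

variable {E ι : Type*} [NormedAddCommGroup E] [NormedSpace ℝ E]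
  {s : Finset ι} {w : ι → ℝ} {L : ι → E →L[ℝ] ℝ} {B : E →L[ℝ] E →L[ℝ] ℝ} {F : E → E}

/-- Monotonicity identity for the weighted logarithmic gradient. -/
theorem pairing_sub_log_gradient
    (hF : ∀ Q, (∀ j ∈ s, 0 < L j Q) → ∀ R, B (F Q) R = ∑ j ∈ s, w j * (L j R / L j Q))
    {Q Q' : E} (hQ : ∀ j ∈ s, 0 < L j Q) (hQ' : ∀ j ∈ s, 0 < L j Q') :
    B (F Q' - F Q) (Q - Q') = ∑ j ∈ s, w j * (L j (Q - Q') ^ 2 / (L j Q * L j Q')) := by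
  rw [map_sub B, sub_apply, hF Q hQ, hF Q' hQ', ← Finset.sum_sub_distrib]
  refine Finset.sum_congr rfl fun j hj => ?_
  have h1 := (hQ j hj).ne'
  have h2 := (hQ' j hj).ne'
  rw [map_sub]
  field_simp

/-- The weighted logarithmic gradient is injective on the open cone. -/
theorem log_gradient_injOn (hw : ∀ j ∈ s, 0 < w j)
    (hL : ∀ x, (∀ j ∈ s, L j x = 0) → x = 0)
    (hF : ∀ Q, (∀ j ∈ s, 0 < L j Q) → ∀ R, B (F Q) R = ∑ j ∈ s, w j * (L j R / L j Q)) :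
    Set.InjOn F {Q | ∀ j ∈ s, 0 < L j Q} := by
  intro Q hQ Q' hQ' h
  have h0 := pairing_sub_log_gradient hF hQ hQ'
  rw [h, sub_self, map_zero, zero_apply, eq_comm,
    Finset.sum_eq_zero_iff_of_nonneg fun j hj => mul_nonneg (hw j hj).le
      (div_nonneg (sq_nonneg _) (mul_pos (hQ j hj) (hQ' j hj)).le)] at h0
  refine sub_eq_zero.mp (hL _ fun j hj => ?_)
  have := h0 j hj
  simpa [(hw j hj).ne', (hQ j hj).ne', (hQ' j hj).ne'] using this

variable [FiniteDimensional ℝ E]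

/-- A functional that is positive on a closed polyhedral cone away from the origin dominates
a multiple of the norm there. -/
theorem exists_mul_norm_le_of_pos_on_cone {f : E →L[ℝ] ℝ}
    (hf : ∀ p, (∀ j ∈ s, 0 ≤ L j p) → p ≠ 0 → 0 < f p) :
    ∃ ε : ℝ, 0 < ε ∧ ∀ p, (∀ j ∈ s, 0 ≤ L j p) → ε * ‖p‖ ≤ f p := by
  have hclosed : IsClosed {p : E | ∀ j ∈ s, 0 ≤ L j p} := by
    simp only [Set.ofPred_forall]
    exact isClosed_iInter fun j => isClosed_iInter fun _ =>
      isClosed_le continuous_const (L j).continuous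
  have hK : IsCompact (Metric.sphere (0 : E) 1 ∩ {p : E | ∀ j ∈ s, 0 ≤ L j p}) :=
    (isCompact_sphere 0 1).inter_right hclosed
  obtain ⟨ε, hε, h⟩ := hK.exists_forall_le' (f := f) (a := 0) f.continuous.continuousOn (by
    rintro p ⟨hp1, hp⟩
    refine hf p hp ?_
    rintro rfl
    simp at hp1)
  refine ⟨ε, hε, fun p hp => ?_⟩
  rcases eq_or_ne p 0 with rfl | hp0
  · simp
  have hn : 0 < ‖p‖ := norm_pos_iff.mpr hp0
  have := h (‖p‖⁻¹ • p) ⟨by simp [norm_smul, hn.ne'], fun j hj => by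
    simpa using mul_nonneg (inv_nonneg.mpr hn.le) (hp j hj)⟩
  rw [map_smul, smul_eq_mul, inv_mul_eq_div, le_div_iff₀ hn] at this
  exact this

/-- A functional positive on the closed cone is represented as a weighted logarithmic gradient
at some interior point. -/
theorem exists_log_gradient_eq (hs : s.Nonempty) (hw : ∀ j ∈ s, 0 < w j)
    (hne : ∃ Q, ∀ j ∈ s, 0 < L j Q) {f : E →L[ℝ] ℝ}
    (hf : ∀ p, (∀ j ∈ s, 0 ≤ L j p) → p ≠ 0 → 0 < f p) :
    ∃ Q, (∀ j ∈ s, 0 < L j Q) ∧ ∀ R, ∑ j ∈ s, w j * (L j R / L j Q) = f R := by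
  obtain ⟨ε, hε, hbound⟩ := exists_mul_norm_le_of_pos_on_cone hf
  have hfpos : ∀ Q, (∀ j ∈ s, 0 < L j Q) → 0 < f Q := by
    intro Q hQ
    refine hf Q (fun j hj => (hQ j hj).le) ?_
    rintro rfl
    obtain ⟨j, hj⟩ := hs
    simpa using hQ j hj
  set W := ∑ j ∈ s, w j with hW
  have hWpos : 0 < W := Finset.sum_pos hw hs
  set K : Set E := {p | (∀ j ∈ s, 0 ≤ L j p) ∧ f p = 1} with hKdef
  have hK : IsCompact K := by
    refine Metric.isCompact_of_isClosed_isBounded ?_ ?_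
    · refine IsClosed.and ?_ (isClosed_eq f.continuous continuous_const)
      simp only [Set.ofPred_forall]
      exact isClosed_iInter fun j => isClosed_iInter fun _ =>
        isClosed_le continuous_const (L j).continuous
    · refine (Metric.isBounded_closedBall (x := (0 : E)) (r := 1 / ε)).subset ?_
      rintro p ⟨hp, hp1⟩
      have := hbound p hp
      rw [mem_closedBall_zero_iff, le_div_iff₀ hε]
      linarith
  have hscale : ∀ Q, (∀ j ∈ s, 0 < L j Q) → (f Q)⁻¹ • Q ∈ K := by
    intro Q hQ
    have := hfpos Q hQ
    refine ⟨fun j hj => ?_, ?_⟩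
    · simpa using mul_nonneg (inv_nonneg.mpr this.le) (hQ j hj).le
    · simp [this.ne']
  set g : E → ℝ := fun Q => ∏ j ∈ s, L j Q ^ w j with hg
  have hgc : Continuous g := continuous_finsetProd _ fun j hj =>
    (L j).continuous.rpow_const fun _ => Or.inr (hw j hj).le
  obtain ⟨Q₁, hQ₁⟩ := hne
  obtain ⟨Q, hQK, hmax⟩ := hK.exists_isMaxOn ⟨_, hscale Q₁ hQ₁⟩ hgc.continuousOn
  have hgpos : 0 < g Q := by
    refine lt_of_lt_of_le ?_ (hmax (hscale Q₁ hQ₁))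
    refine Finset.prod_pos fun j hj => Real.rpow_pos_of_pos ?_ _
    simpa using mul_pos (inv_pos.mpr (hfpos Q₁ hQ₁)) (hQ₁ j hj)
  have hQ : ∀ j ∈ s, 0 < L j Q := by
    intro j hj
    refine (hQK.1 j hj).lt_of_ne fun h0 => hgpos.ne' ?_
    exact Finset.prod_eq_zero hj (by rw [← h0, Real.zero_rpow (hw j hj).ne'])
  have hlog : ∀ X, (∀ j ∈ s, 0 < L j X) → Real.log (g X) = ∑ j ∈ s, w j * Real.log (L j X) := by
    intro X hX
    rw [hg, Real.log_prod fun j hj => (Real.rpow_pos_of_pos (hX j hj) _).ne']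
    exact Finset.sum_congr rfl fun j hj => Real.log_rpow (hX j hj) _
  set G : E → ℝ := fun X => ∑ j ∈ s, w j * Real.log (L j X) - W * Real.log (f X) with hG
  have hGmax : ∀ X, (∀ j ∈ s, 0 < L j X) → G X ≤ G Q := by
    intro X hX
    have hfX := hfpos X hX
    have hpos : ∀ j ∈ s, 0 < L j ((f X)⁻¹ • X) := fun j hj => by
      simpa using mul_pos (inv_pos.mpr hfX) (hX j hj)
    have h1 : Real.log (g ((f X)⁻¹ • X)) ≤ Real.log (g Q) :=
      Real.log_le_log (Finset.prod_pos fun j hj => Real.rpow_pos_of_pos (hpos j hj) _)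
        (hmax (hscale X hX))
    rw [hlog _ hpos, hlog _ hQ] at h1
    have h2 : ∑ j ∈ s, w j * Real.log (L j ((f X)⁻¹ • X)) = G X := by
      rw [hG, hW]
      simp only [Finset.sum_mul, ← Finset.sum_sub_distrib]
      refine Finset.sum_congr rfl fun j hj => ?_
      rw [map_smul, smul_eq_mul, Real.log_mul (inv_ne_zero hfX.ne') (hX j hj).ne', Real.log_inv]
      ring
    have h3 : G Q = ∑ j ∈ s, w j * Real.log (L j Q) := by simp [hG, hQK.2]
    linarith
  have hcrit : ∀ R, ∑ j ∈ s, w j * (L j R / L j Q) = W * f R := by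
    intro R
    have hline : ∀ φ : E →L[ℝ] ℝ, HasDerivAt (fun t : ℝ => φ (Q + t • R)) (φ R) 0 := by
      intro φ
      simpa using ((hasDerivAt_id (0 : ℝ)).mul_const (φ R)).const_add (φ Q)
    have hder : HasDerivAt (fun t : ℝ => G (Q + t • R))
        (∑ j ∈ s, w j * (L j R / L j Q) - W * (f R / f Q)) 0 := by
      refine HasDerivAt.sub (HasDerivAt.fun_sum fun j hj => ?_) ?_
      · simpa using ((hline (L j)).log (by simpa using (hQ j hj).ne')).const_mul (w j)
      · simpa using ((hline f).log (by simp [hQK.2])).const_mul W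
    have hloc : IsLocalMax (fun t : ℝ => G (Q + t • R)) 0 := by
      have : ∀ᶠ t : ℝ in 𝓝 0, ∀ j ∈ s, 0 < L j (Q + t • R) := by
        refine (Filter.eventually_all_finset s).mpr fun j hj => ?_
        exact (hline (L j)).continuousAt.eventually_const_lt (by simpa using hQ j hj)
      filter_upwards [this] with t ht
      simpa using hGmax _ ht
    have := hloc.hasDerivAt_eq_zero hder
    rw [hQK.2, div_one] at this
    linarith
  refine ⟨W • Q, fun j hj => by simpa using mul_pos hWpos (hQ j hj), fun R => ?_⟩
  rw [← mul_right_inj' hWpos.ne', ← hcrit R, Finset.mul_sum]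
  refine Finset.sum_congr rfl fun j hj => ?_
  have := (hQ j hj).ne'
  rw [map_smul, smul_eq_mul]
  field_simp

/-- The inverse of the weighted logarithmic gradient is continuous. -/
theorem tendsto_of_tendsto_log_gradient {α : Type*} {l : Filter α} (hw : ∀ j ∈ s, 0 < w j)
    (hL : ∀ x, (∀ j ∈ s, L j x = 0) → x = 0)
    (hF : ∀ Q, (∀ j ∈ s, 0 < L j Q) → ∀ R, B (F Q) R = ∑ j ∈ s, w j * (L j R / L j Q))
    {Q : E} (hQ : ∀ j ∈ s, 0 < L j Q)
    (hdual : ∀ p, (∀ j ∈ s, 0 ≤ L j p) → p ≠ 0 → 0 < B (F Q) p)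
    {u : α → E} (hu : ∀ a, ∀ j ∈ s, 0 < L j (u a))
    (hlim : Tendsto (fun a => F (u a)) l (𝓝 (F Q))) :
    Tendsto u l (𝓝 Q) := by
  obtain ⟨ε, hε, hbound⟩ := exists_mul_norm_le_of_pos_on_cone hdual
  have hself : ∀ a, B (F (u a)) (u a) = ∑ j ∈ s, w j := by
    intro a
    rw [hF _ (hu a)]
    exact Finset.sum_congr rfl fun j hj => by rw [div_self (hu a j hj).ne', mul_one]
  set W := ∑ j ∈ s, w j
  have hBlim : Tendsto (fun a => ‖B (F Q - F (u a))‖) l (𝓝 0) := by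
    have h : Tendsto (fun a => F Q - F (u a)) l (𝓝 0) := by
      simpa using (tendsto_const_nhds (x := F Q)).sub hlim
    simpa using ((B.continuous.tendsto 0).comp h).norm
  have hubdd : ∀ᶠ a in l, ‖u a‖ ≤ 2 * W / ε := by
    filter_upwards [hBlim.eventually_lt_const (half_pos hε)] with a ha
    have h1 := hbound (u a) fun j hj => (hu a j hj).le
    have h2 := (le_abs_self _).trans ((B (F Q - F (u a))).le_opNorm (u a))
    rw [map_sub, sub_apply, hself, ← map_sub] at h2
    have h3 := mul_le_mul_of_nonneg_right ha.le (norm_nonneg (u a))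
    rw [le_div_iff₀ hε]
    linarith
  set M := 2 * W / ε
  set T : E →L[ℝ] (s → ℝ) := ContinuousLinearMap.pi fun j : s => L j
  have hT : IsClosedEmbedding T := by
    refine LinearMap.isClosedEmbedding_of_injective (f := (T : E →ₗ[ℝ] (s → ℝ))) ?_
    refine LinearMap.ker_eq_bot'.mpr fun x hx => hL x fun j hj => ?_
    exact congrFun hx ⟨j, hj⟩
  rw [hT.isInducing.tendsto_nhds_iff, tendsto_pi_nhds]
  rintro ⟨j, hj⟩
  change Tendsto (fun a => L j (u a)) l (𝓝 (L j Q))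
  set C := (‖L j‖ * M * L j Q) / w j * (M + ‖Q‖)
  have hsq : Tendsto (fun a => (L j (u a - Q)) ^ 2) l (𝓝 0) := by
    refine squeeze_zero' (g := fun a => C * ‖B (F Q - F (u a))‖)
      (Eventually.of_forall fun a => sq_nonneg _) ?_ (by simpa using hBlim.const_mul C)
    filter_upwards [hubdd] with a ha
    have hwj := hw j hj
    have hQj := hQ j hj
    have huj := hu a j hj
    have h1 : w j * (L j (u a - Q) ^ 2 / (L j (u a) * L j Q)) ≤
        ‖B (F Q - F (u a))‖ * (M + ‖Q‖) := by
      calc w j * (L j (u a - Q) ^ 2 / (L j (u a) * L j Q))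
          ≤ B (F Q - F (u a)) (u a - Q) := by
            rw [pairing_sub_log_gradient hF (hu a) hQ]
            exact Finset.single_le_sum
              (f := fun i => w i * (L i (u a - Q) ^ 2 / (L i (u a) * L i Q)))
              (fun i hi => mul_nonneg (hw i hi).le
                (div_nonneg (sq_nonneg _) (mul_pos (hu a i hi) (hQ i hi)).le)) hj
        _ ≤ ‖B (F Q - F (u a))‖ * ‖u a - Q‖ :=
            (le_abs_self _).trans ((B (F Q - F (u a))).le_opNorm _)
        _ ≤ _ := by
            gcongr
            exact (norm_sub_le _ _).trans (by gcongr)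
    have h2 : L j (u a) ≤ ‖L j‖ * M :=
      (le_abs_self _).trans (((L j).le_opNorm _).trans (by gcongr))
    have hX : 0 ≤ ‖B (F Q - F (u a))‖ * (M + ‖Q‖) := le_trans (by positivity) h1
    calc L j (u a - Q) ^ 2
        = (L j (u a) * L j Q / w j) * (w j * (L j (u a - Q) ^ 2 / (L j (u a) * L j Q))) := by
          field_simp
      _ ≤ (L j (u a) * L j Q / w j) * (‖B (F Q - F (u a))‖ * (M + ‖Q‖)) := by gcongr
      _ ≤ (‖L j‖ * M * L j Q / w j) * (‖B (F Q - F (u a))‖ * (M + ‖Q‖)) := by gcongr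
      _ = _ := by ring
  have habs : Tendsto (fun a => |L j (u a - Q)|) l (𝓝 0) := by
    simpa [Real.sqrt_sq_eq_abs] using hsq.sqrt
  have := (tendsto_zero_iff_abs_tendsto_zero _).mpr habs
  simpa using this.add_const (L j Q)

/-- The weighted logarithmic gradient of an open polyhedral cone is a homeomorphism onto the
open dual cone. -/
theorem exists_homeomorph_log_gradient (hs : s.Nonempty) (hw : ∀ j ∈ s, 0 < w j)
    (hL : ∀ x, (∀ j ∈ s, L j x = 0) → x = 0) (hB : ∀ c, (∀ x, B c x = 0) → c = 0)
    (hF : ∀ Q, (∀ j ∈ s, 0 < L j Q) → ∀ R, B (F Q) R = ∑ j ∈ s, w j * (L j R / L j Q))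
    (hFc : ContinuousOn F {Q | ∀ j ∈ s, 0 < L j Q}) (hne : ∃ Q, ∀ j ∈ s, 0 < L j Q) :
    ∃ H : {Q | ∀ j ∈ s, 0 < L j Q} ≃ₜ {c | ∀ p, (∀ j ∈ s, 0 ≤ L j p) → p ≠ 0 → 0 < B c p},
      ∀ Q, (H Q : E) = F Q := by
  have hmem : ∀ Q, (∀ j ∈ s, 0 < L j Q) →
      ∀ p, (∀ j ∈ s, 0 ≤ L j p) → p ≠ 0 → 0 < B (F Q) p := by
    intro Q hQ p hp hp0
    rw [hF Q hQ]
    refine Finset.sum_pos' (fun j hj => mul_nonneg (hw j hj).le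
      (div_nonneg (hp j hj) (hQ j hj).le)) ?_
    by_contra! hcon
    refine hp0 (hL p fun j hj => le_antisymm ?_ (hp j hj))
    by_contra! hpos
    exact absurd (hcon j hj) (not_le.mpr (mul_pos (hw j hj) (div_pos hpos (hQ j hj))))
  let Φ : {Q | ∀ j ∈ s, 0 < L j Q} → {c | ∀ p, (∀ j ∈ s, 0 ≤ L j p) → p ≠ 0 → 0 < B c p} :=
    fun Q => ⟨F Q, hmem Q Q.2⟩
  have hbij : Function.Bijective Φ := by
    constructor
    · intro Q Q' h
      exact Subtype.ext (log_gradient_injOn hw hL hF Q.2 Q'.2 (congrArg Subtype.val h))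
    · rintro ⟨c, hc⟩
      obtain ⟨Q, hQ, hQc⟩ := exists_log_gradient_eq hs hw hne hc
      refine ⟨⟨Q, hQ⟩, Subtype.ext (sub_eq_zero.mp (hB _ fun x => ?_))⟩
      rw [map_sub, sub_apply, hF Q hQ, hQc, sub_self]
  let e := Equiv.ofBijective Φ hbij
  have hright : ∀ c, F (e.symm c) = c := fun c => congrArg Subtype.val (e.apply_symm_apply c)
  refine ⟨⟨e, (continuousOn_iff_continuous_domRestrict.mp hFc).subtype_mk _, ?_⟩, fun Q => rfl⟩
  refine continuous_iff_continuousAt.mpr fun c => tendsto_subtype_rng.mpr ?_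
  refine tendsto_of_tendsto_log_gradient hw hL hF (e.symm c).2 (hmem _ (e.symm c).2)
    (fun a => (e.symm a).2) ?_
  change Tendsto (fun a => F (e.symm a)) (𝓝 c) (𝓝 (F (e.symm c)))
  simp only [hright]
  exact continuous_subtype_val.tendsto c

end ConeMoment

section TrigonometricPolynomials

variable {n N : ℕ}

theorem zet_ne_zero (N : ℕ) (j : ℤ) : zet N j ≠ 0 := Complex.exp_ne_zero _

theorem conj_zet (N : ℕ) (j : ℤ) : (starRingEnd ℂ) (zet N j) = (zet N j)⁻¹ := by
  rw [zet, ← Complex.exp_conj, ← Complex.exp_neg]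
  congr 1
  simp [neg_div]

theorem zet_injOn (hN : 0 < N) : Set.InjOn (zet N) (idxs N) := by
  intro j hj k hk h
  obtain ⟨m, hm⟩ := Complex.exp_eq_exp_iff_exists_int.mp h
  have hN' : (N : ℂ) ≠ 0 := by exact_mod_cast hN.ne'
  have hπ : (Real.pi * Complex.I : ℂ) ≠ 0 := by simp [Real.pi_ne_zero]
  have h1 : (j : ℂ) = k + m * (2 * N) := by
    apply mul_left_cancel₀ hπ
    field_simp at hm
    linear_combination (Real.pi * Complex.I) * hm
  have h2 : j = k + m * (2 * N) := by exact_mod_cast h1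
  simp only [idxs, Finset.coe_Icc, Set.mem_Icc] at hj hk
  have hm0 : m = 0 := by
    by_contra hm0
    rcases lt_or_gt_of_ne hm0 with h | h
    · nlinarith [show m ≤ -1 by omega]
    · nlinarith [show 1 ≤ m by omega]
  simpa [hm0] using h2

theorem evalC_zet (p : Coef n) (j : ℤ) : evalC p (zet N j) = (evalR p (zet N j) : ℂ) := by
  refine (Complex.conj_eq_iff_re.mp ?_).symm
  simp only [evalC, map_add, map_sum, map_mul, map_pow, map_inv₀, conj_zet, Complex.conj_conj,
    Complex.conj_ofReal, inv_inv]
  simp only [add_comm]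

/-- Value of a trigonometric polynomial at a root of unity in terms of real parts. -/
theorem evalR_zet (p : Coef n) (j : ℤ) : evalR p (zet N j) =
    p.1 + ∑ k : Fin n, 2 * (zet N j ^ ((k : ℕ) + 1) * (starRingEnd ℂ) (p.2 k)).re := by
  have h : ∀ k : Fin n, (p.2 k * (zet N j)⁻¹ ^ ((k : ℕ) + 1)).re =
      (zet N j ^ ((k : ℕ) + 1) * (starRingEnd ℂ) (p.2 k)).re := by
    intro k
    rw [← Complex.conj_re, map_mul, map_pow, map_inv₀, conj_zet, inv_inv, mul_comm]
  simp only [evalR, evalC, Complex.add_re, Complex.ofReal_re, Complex.re_sum, h]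
  congr 1
  refine Finset.sum_congr rfl fun k _ => ?_
  rw [mul_comm ((starRingEnd ℂ) (p.2 k)), two_mul]

/-- A trigonometric polynomial of degree less than `N` vanishing at all `2N`-th roots of unity
is zero. -/
theorem eq_zero_of_evalR_zet_eq_zero (hnN : n < N) {p : Coef n}
    (hp : ∀ j ∈ idxs N, evalR p (zet N j) = 0) : p = 0 := by
  classical
  let q : Polynomial ℂ := Polynomial.monomial n (p.1 : ℂ) + ∑ k : Fin n,
    (Polynomial.monomial (n - (k + 1)) (p.2 k) +
      Polynomial.monomial (n + (k + 1)) ((starRingEnd ℂ) (p.2 k)))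
  have heval : ∀ z : ℂ, z ≠ 0 → q.eval z = z ^ n * evalC p z := by
    intro z hz
    simp only [q, evalC, Polynomial.eval_add, Polynomial.eval_finsetSum,
      Polynomial.eval_monomial, mul_add, Finset.mul_sum]
    congr 1
    · ring
    · refine Finset.sum_congr rfl fun k _ => ?_
      have hk : (k : ℕ) + 1 ≤ n := k.2
      rw [pow_sub₀ z hz hk, inv_pow, pow_add]
      ring
  have hdeg : q.natDegree ≤ 2 * n := by
    refine Polynomial.natDegree_add_le_of_degree_le
      ((Polynomial.natDegree_monomial_le _).trans (by omega)) ?_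
    refine Polynomial.natDegree_sum_le_of_forall_le _ _ fun k _ => ?_
    have hk : (k : ℕ) + 1 ≤ n := k.2
    exact Polynomial.natDegree_add_le_of_degree_le
      ((Polynomial.natDegree_monomial_le _).trans (by omega))
      ((Polynomial.natDegree_monomial_le _).trans (by omega))
  have hcard : ((idxs N).image (zet N)).card = 2 * N := by
    rw [Finset.card_image_of_injOn (zet_injOn (by omega)), idxs, Int.card_Icc]
    omega
  have hq : q = 0 := by
    refine Polynomial.eq_zero_of_natDegree_lt_card_of_eval_eq_zero' q
      ((idxs N).image (zet N)) ?_ (by omega)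
    intro z hz
    obtain ⟨j, hj, rfl⟩ := Finset.mem_image.mp hz
    rw [heval _ (zet_ne_zero N j), evalC_zet, hp j hj, Complex.ofReal_zero, mul_zero]
  have hcoeff : ∀ m, q.coeff m = 0 := fun m => by rw [hq, Polynomial.coeff_zero]
  simp only [q, Polynomial.coeff_add, Polynomial.finsetSum_coeff,
    Polynomial.coeff_monomial] at hcoeff
  refine Prod.ext ?_ (funext fun i => ?_)
  · have h := hcoeff n
    rw [Finset.sum_eq_zero] at h
    · simpa using h
    · intro k _
      have hk : (k : ℕ) + 1 ≤ n := k.2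
      rw [if_neg (by omega), if_neg (by omega), add_zero]
  · have h := hcoeff (n + (i + 1))
    rw [if_neg (by omega), zero_add, Finset.sum_eq_single i] at h
    · rw [if_neg (by omega), if_pos rfl, zero_add] at h
      simpa using h
    · intro k _ hki
      have hki' : (k : ℕ) ≠ i := fun h => hki (Fin.ext h)
      rw [if_neg (by omega), if_neg (by omega), add_zero]
    · simp

/-- Evaluation at a point as a continuous linear functional. -/
def evalCLM (n : ℕ) (z : ℂ) : Coef n →L[ℝ] ℝ :=
  LinearMap.toContinuousLinearMap
    { toFun := fun p => evalR p z
      map_add' := fun p q => by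
        simp only [evalR, evalC, Prod.fst_add, Prod.snd_add, Pi.add_apply, map_add, add_mul,
          Complex.ofReal_add, Complex.add_re, Complex.re_sum, Finset.sum_add_distrib]
        ring
      map_smul' := fun a p => by
        simp [evalR, evalC, Finset.mul_sum, mul_add, mul_assoc] }

@[simp]
theorem evalCLM_apply (z : ℂ) (p : Coef n) : evalCLM n z p = evalR p z := rfl

/-- The pairing `⟨C,P⟩` as a continuous bilinear form. -/
def pairCLM (n : ℕ) : Coef n →L[ℝ] Coef n →L[ℝ] ℝ :=
  LinearMap.toContinuousLinearMap (LinearMap.toContinuousLinearMap.toLinearMap ∘ₗ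
    LinearMap.mk₂ ℝ (fun c p : Coef n => pairCP c p)
      (fun c d p => by
        simp only [pairCP, Prod.fst_add, Prod.snd_add, Pi.add_apply, add_mul, Complex.add_re,
          mul_add, Finset.sum_add_distrib]
        ring)
      (fun a c p => by
        simp only [pairCP, Prod.smul_fst, Prod.smul_snd, Pi.smul_apply, smul_eq_mul,
          smul_mul_assoc, Complex.smul_re, mul_add, Finset.mul_sum]
        congr 1
        · ring
        · exact Finset.sum_congr rfl fun k _ => by ring)
      (fun c p q => by
        simp only [pairCP, Prod.fst_add, Prod.snd_add, Pi.add_apply, map_add, Complex.add_re,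
          mul_add, Finset.sum_add_distrib]
        ring)
      (fun a c p => by
        simp only [pairCP, Prod.smul_fst, Prod.smul_snd, Pi.smul_apply, smul_eq_mul,
          Complex.real_smul, map_mul, Complex.conj_ofReal, mul_left_comm _ (a : ℂ),
          Complex.re_ofReal_mul, mul_add, Finset.mul_sum]
        congr 1
        · ring
        · exact Finset.sum_congr rfl fun k _ => by ring))

@[simp]
theorem pairCLM_apply (c p : Coef n) : pairCLM n c p = pairCP c p := rfl

theorem eq_zero_of_pairCP_self_eq_zero {c : Coef n} (h : pairCP c c = 0) : c = 0 := by
  have hterm : ∀ k : Fin n, 0 ≤ 2 * (c.2 k * (starRingEnd ℂ) (c.2 k)).re := fun k => by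
    rw [Complex.mul_conj, Complex.ofReal_re]
    exact mul_nonneg two_pos.le (Complex.normSq_nonneg _)
  have hsum := Finset.sum_nonneg fun k (_ : k ∈ Finset.univ) => hterm k
  rw [pairCP, add_eq_zero_iff_of_nonneg (mul_self_nonneg _) hsum,
    Finset.sum_eq_zero_iff_of_nonneg fun k _ => hterm k] at h
  refine Prod.ext (mul_self_eq_zero.mp h.1) (funext fun k => ?_)
  have hk := h.2 k (Finset.mem_univ k)
  rw [Complex.mul_conj, Complex.ofReal_re] at hk
  exact Complex.normSq_eq_zero.mp (by linarith)

theorem pairCP_Fmap (P Q R : Coef n) : pairCP (Fmap N P Q) R =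
    ∑ j ∈ idxs N, evalR P (zet N j) / (2 * N) * (evalR R (zet N j) / evalR Q (zet N j)) := by
  have hc : ∀ Φ : ℤ → ℝ, ∀ m : ℤ, ∀ a : ℂ, (dmom N Φ m * a).re =
      ∑ j ∈ idxs N, Φ j / (2 * N) * (zet N j ^ m * a).re := by
    intro Φ m a
    rw [dmom, Finset.mul_sum, Finset.sum_mul, Complex.re_sum]
    refine Finset.sum_congr rfl fun j _ => ?_
    rw [← Complex.re_ofReal_mul]
    congr 1
    push_cast
    ring
  have h0 : (dmom N (phiOf N P Q) 0).re = ∑ j ∈ idxs N, phiOf N P Q j / (2 * N) := by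
    simpa using hc (phiOf N P Q) 0 1
  simp only [pairCP, Fmap, h0, hc]
  simp only [evalR_zet R, phiOf, Finset.mul_sum, Finset.sum_mul, add_div, mul_add,
    Finset.sum_add_distrib, Finset.sum_div]
  rw [Finset.sum_comm]
  congr 1
  · exact Finset.sum_congr rfl fun j _ => by ring
  · refine Finset.sum_congr rfl fun j _ => Finset.sum_congr rfl fun k _ => ?_
    norm_cast
    ring

theorem continuousOn_Fmap (P : Coef n) : ContinuousOn (Fmap N P) (Pplus n N) := by
  have h : ∀ m : ℤ, ContinuousOn (fun Q => dmom N (phiOf N P Q) m) (Pplus n N) := by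
    intro m
    refine continuousOn_const.mul (continuousOn_finsetSum _ fun j hj => continuousOn_const.mul ?_)
    refine Complex.continuous_ofReal.comp_continuousOn (continuousOn_const.div
      (evalCLM n (zet N j)).continuous.continuousOn fun Q hQ => (hQ j hj).ne')
  exact (Complex.continuous_re.comp_continuousOn (h 0)).prodMk
    (continuousOn_pi.mpr fun k => h _)

end TrigonometricPolynomials

/-- **Theorem 3, first part.** For `P ∈ 𝔓₊(N)`, the moment map
`F^P : 𝔓₊(N) → ℭ₊(N)` is a homeomorphism. -/
theorem Fmap_homeomorphism
    (n N : ℕ) (hn : 1 ≤ n) (hnN : n < N) (P : Coef n) (hP : P ∈ Pplus n N) :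
    ∃ H : (Pplus n N) ≃ₜ (Cplus n N),
      ∀ Q : Pplus n N, (H Q : Coef n) = Fmap N P (Q : Coef n) := by
  have hN : 0 < N := by omega
  exact exists_homeomorph_log_gradient (s := idxs N) (L := fun j => evalCLM n (zet N j))
    (w := fun j => evalR P (zet N j) / (2 * N)) (B := pairCLM n) (F := Fmap N P)
    ⟨N, by simp [idxs]; omega⟩
    (fun j hj => div_pos (hP j hj) (by positivity))
    (fun p hp => eq_zero_of_evalR_zet_eq_zero hnN hp)
    (fun c hc => eq_zero_of_pairCP_self_eq_zero (hc c))
    (fun Q _ R => pairCP_Fmap P Q R)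
    (continuousOn_Fmap P) ⟨P, hP⟩
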